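/- arXiv:2507.00204 — 2 statements merged into one kernel-verified Lean document; each statement's English description precedes it below -/
import Mathlib

section
/- For every dimension n ≥ 2 and every exponent p with 1 ≤ p < 4n/(3n+1), there exists a constant C > 0 such that for every Schwartz function f on ℝⁿ, the L² norm of the restriction of the Fourier transform of f to the unit sphere S^{n-1} (with respect to the canonical surface measure) is at most C times the Lᵖ norm of f. -/
open MeasureTheory FourierTransform Real

noncomputable section

/-- The oscillatory integral `∫ exp(i l sin θ) u(θ) dθ` over `[a, b]`. -/
def sinOsc (l a b : ℝ) (u : ℝ → ℝ) : ℂ :=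
  ∫ x in a..b, Complex.exp ((l * Real.sin x : ℝ) * Complex.I) * (u x : ℂ)

lemma norm_sinOsc_le {l a b : ℝ} (hab : a ≤ b) {u g : ℝ → ℝ}
    (hu : ∀ x ∈ Set.Icc a b, |u x| ≤ g x) (hg : IntervalIntegrable g volume a b) :
    ‖sinOsc l a b u‖ ≤ ∫ x in a..b, g x := by
  refine intervalIntegral.norm_integral_le_of_norm_le hab (Filter.Eventually.of_forall ?_) hg
  intro x hx
  rw [norm_mul, Complex.norm_exp_ofReal_mul_I, one_mul, Complex.norm_real]
  exact hu x (Set.Ioc_subset_Icc_self hx)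

lemma intervalIntegrable_sinOsc {l a b : ℝ} {u : ℝ → ℝ} (hu : ContinuousOn u (Set.uIcc a b)) :
    IntervalIntegrable (fun x => Complex.exp ((l * Real.sin x : ℝ) * Complex.I) * (u x : ℂ))
      volume a b := by
  apply ContinuousOn.intervalIntegrable
  apply ContinuousOn.mul (by fun_prop)
  exact Complex.continuous_ofReal.comp_continuousOn hu

lemma sinOsc_cos_mul {l a b : ℝ} (hl : l ≠ 0) {u u' : ℝ → ℝ}
    (hu : ∀ x ∈ Set.uIcc a b, HasDerivAt u (u' x) x) (hu' : ContinuousOn u' (Set.uIcc a b)) :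
    sinOsc l a b (fun x => Real.cos x * u x) = (l * Complex.I)⁻¹ *
      (Complex.exp ((l * Real.sin b : ℝ) * Complex.I) * (u b : ℂ)
        - Complex.exp ((l * Real.sin a : ℝ) * Complex.I) * (u a : ℂ) - sinOsc l a b u') := by
  have hlI : (l : ℂ) * Complex.I ≠ 0 := mul_ne_zero (by exact_mod_cast hl) Complex.I_ne_zero
  have hv : ∀ x ∈ Set.uIcc a b,
      HasDerivAt (fun x : ℝ => Complex.exp ((l * Real.sin x : ℝ) * Complex.I))
        (Complex.exp ((l * Real.sin x : ℝ) * Complex.I) * ((l * Real.cos x : ℝ) * Complex.I)) x := by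
    intro x _
    exact ((((Real.hasDerivAt_sin x).const_mul l).ofReal_comp).mul_const Complex.I).cexp
  have key := intervalIntegral.integral_mul_deriv_eq_deriv_mul
    (u := fun x => (u x : ℂ)) (u' := fun x => (u' x : ℂ)) (fun x hx => (hu x hx).ofReal_comp) hv
    (Complex.continuous_ofReal.comp_continuousOn hu').intervalIntegrable
    (ContinuousOn.intervalIntegrable (by fun_prop))
  rw [eq_inv_mul_iff_mul_eq₀ hlI]
  unfold sinOsc
  rw [← intervalIntegral.integral_const_mul]
  convert key using 2
  · ext x; push_cast; ring
  · ring
  · congr 1; ext x; ring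

lemma norm_sinOsc_cos_mul_le {l a b : ℝ} (hl : l ≠ 0) {u u' : ℝ → ℝ}
    (hu : ∀ x ∈ Set.uIcc a b, HasDerivAt u (u' x) x) (hu' : ContinuousOn u' (Set.uIcc a b)) :
    ‖sinOsc l a b (fun x => Real.cos x * u x)‖ ≤ |l|⁻¹ *
      (|u b| + |u a| + ‖sinOsc l a b u'‖) := by
  rw [sinOsc_cos_mul hl hu hu', norm_mul, norm_inv, norm_mul, Complex.norm_real, Complex.norm_I,
    mul_one, Real.norm_eq_abs]
  gcongr
  refine (norm_sub_le _ _).trans ?_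
  gcongr
  refine (norm_sub_le _ _).trans ?_
  simp only [norm_mul, Complex.norm_exp_ofReal_mul_I, one_mul, Complex.norm_real,
    Real.norm_eq_abs, le_refl]

/-- Van der Corput estimate for the phase `sin`, whose critical points are the endpoints. -/
lemma norm_sinOsc_le_inv_sqrt {l : ℝ} (hl : 1 ≤ |l|) {w w' : ℝ → ℝ}
    (hw : ∀ x, HasDerivAt w (w' x) x) (hw' : Continuous w') (hb : ∀ x, |w x| ≤ 1)
    (hb' : ∀ x, |w' x * Real.cos x + w x * Real.sin x| ≤ 1) :
    ‖sinOsc l (-(π / 2)) (π / 2) w‖ ≤ (2 + 2 * π) * (√|l|)⁻¹ := by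
  have hl0 : l ≠ 0 := by rintro rfl; norm_num at hl
  set d := (√|l|)⁻¹ with hd
  have hs1 : 1 ≤ √|l| := Real.one_le_sqrt.2 hl
  have hd0 : 0 < d := by positivity
  have hd1 : d ≤ 1 := inv_le_one_of_one_le₀ hs1
  have hdd : |l|⁻¹ = d * d := by rw [hd, ← mul_inv, Real.mul_self_sqrt (abs_nonneg l)]
  have hpi := Real.pi_gt_three
  have hwc : Continuous w := continuous_iff_continuousAt.2 fun x => (hw x).continuousAt
  set c := π / 2 - d with hc
  have hc0 : 0 < c := by rw [hc]; linarith
  have hsplit : sinOsc l (-(π / 2)) (π / 2) w =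
      sinOsc l (-(π / 2)) (-c) w + sinOsc l (-c) c w + sinOsc l c (π / 2) w := by
    unfold sinOsc
    rw [intervalIntegral.integral_add_adjacent_intervals,
      intervalIntegral.integral_add_adjacent_intervals] <;>
    exact intervalIntegrable_sinOsc hwc.continuousOn
  have h1 : ‖sinOsc l (-(π / 2)) (-c) w‖ ≤ d := by
    refine (norm_sinOsc_le (g := fun _ => 1) (by rw [hc]; linarith) (fun x _ => hb x)
      (by simp)).trans ?_
    simp [hc]
  have h3 : ‖sinOsc l c (π / 2) w‖ ≤ d := by
    refine (norm_sinOsc_le (g := fun _ => 1) (by rw [hc]; linarith) (fun x _ => hb x)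
      (by simp)).trans ?_
    simp [hc]
  have hcosc : Real.cos c = Real.sin d := by rw [hc, Real.cos_pi_div_two_sub]
  have hsind : 2 / π * d ≤ Real.sin d := Real.mul_le_sin hd0.le (by linarith)
  have hsind0 : 0 < Real.sin d := lt_of_lt_of_le (by positivity) hsind
  have hinv : (Real.sin d)⁻¹ ≤ π / 2 * d⁻¹ := by
    calc (Real.sin d)⁻¹ ≤ (2 / π * d)⁻¹ := inv_anti₀ (by positivity) hsind
      _ = π / 2 * d⁻¹ := by rw [mul_inv, inv_div]
  have hcos : ∀ x ∈ Set.uIcc (-c) c, 0 < Real.cos x := by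
    intro x hx
    rw [Set.uIcc_of_le (by linarith)] at hx
    exact Real.cos_pos_of_mem_Ioo ⟨by linarith [hx.1], by linarith [hx.2]⟩
  have h2 : ‖sinOsc l (-c) c w‖ ≤ 2 * π * d := by
    have e : sinOsc l (-c) c w = sinOsc l (-c) c (fun x => Real.cos x * (w x / Real.cos x)) := by
      unfold sinOsc
      refine intervalIntegral.integral_congr fun x hx => ?_
      have := (hcos x hx).ne'
      simp only
      rw [mul_div_cancel₀ _ this]
    have hder : ∀ x ∈ Set.uIcc (-c) c, HasDerivAt (fun x => w x / Real.cos x)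
        ((w' x * Real.cos x + w x * Real.sin x) / Real.cos x ^ 2) x := by
      intro x hx
      exact ((hw x).div (Real.hasDerivAt_cos x) (hcos x hx).ne').congr_deriv (by ring)
    have hcont : ContinuousOn (fun x => (w' x * Real.cos x + w x * Real.sin x) / Real.cos x ^ 2)
        (Set.uIcc (-c) c) :=
      ContinuousOn.div (by fun_prop) (by fun_prop) fun x hx => (pow_pos (hcos x hx) 2).ne'
    have hcont' : ContinuousOn (fun x => 1 / Real.cos x ^ 2)
        (Set.uIcc (-c) c) :=
      ContinuousOn.div (by fun_prop) (by fun_prop) fun x hx => (pow_pos (hcos x hx) 2).ne'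
    rw [e]
    refine (norm_sinOsc_cos_mul_le hl0 hder hcont).trans ?_
    have hint : ‖sinOsc l (-c) c (fun x => (w' x * Real.cos x + w x * Real.sin x) /
        Real.cos x ^ 2)‖ ≤ 2 * (Real.sin d)⁻¹ := by
      refine (norm_sinOsc_le (g := fun x => 1 / Real.cos x ^ 2) (by linarith) ?_
        hcont'.intervalIntegrable).trans ?_
      · intro x hx
        rw [abs_div, abs_of_nonneg (sq_nonneg (Real.cos x))]
        gcongr
        exact hb' x
      · rw [intervalIntegral.integral_eq_sub_of_hasDerivAt (f := Real.tan)
          (fun x hx => Real.hasDerivAt_tan (hcos x hx).ne') hcont'.intervalIntegrable,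
          Real.tan_neg, Real.tan_eq_sin_div_cos, hcosc, div_eq_mul_inv]
        nlinarith [Real.sin_le_one c, inv_pos.2 hsind0]
    have hub : ∀ x, Real.cos x = Real.sin d → |w x / Real.cos x| ≤ (Real.sin d)⁻¹ := by
      intro x hx
      rw [hx, abs_div, abs_of_pos hsind0, div_eq_mul_inv]
      exact mul_le_of_le_one_left (inv_pos.2 hsind0).le (hb x)
    have hb1 := hub c hcosc
    have hb2 := hub (-c) (by rw [Real.cos_neg, hcosc])
    calc _ ≤ |l|⁻¹ * ((Real.sin d)⁻¹ + (Real.sin d)⁻¹ + 2 * (Real.sin d)⁻¹) := by gcongr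
      _ ≤ d * d * (4 * (π / 2 * d⁻¹)) := by rw [hdd]; gcongr; linarith
      _ = 2 * π * d := by field_simp; ring
  rw [hsplit]
  calc _ ≤ ‖sinOsc l (-(π / 2)) (-c) w‖ + ‖sinOsc l (-c) c w‖ + ‖sinOsc l c (π / 2) w‖ :=
        norm_add₃_le
    _ ≤ (2 + 2 * π) * d := by linarith

lemma sinOsc_const_mul (l a b c : ℝ) (u : ℝ → ℝ) :
    sinOsc l a b (fun x => c * u x) = c * sinOsc l a b u := by
  unfold sinOsc
  rw [← intervalIntegral.integral_const_mul]
  congr 1; ext x; push_cast; ring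

lemma sinOsc_sub {l a b : ℝ} {u v : ℝ → ℝ} (hu : Continuous u) (hv : Continuous v) :
    sinOsc l a b (fun x => u x - v x) = sinOsc l a b u - sinOsc l a b v := by
  unfold sinOsc
  rw [← intervalIntegral.integral_sub (intervalIntegrable_sinOsc hu.continuousOn)
    (intervalIntegrable_sinOsc hv.continuousOn)]
  congr 1; ext x; push_cast; ring

/-- Decay of the Bessel-type integrals `∫ exp(i l sin θ) cos^m θ dθ`. -/
lemma sinOsc_cos_pow_decay (m : ℕ) : ∃ C : ℝ, 0 ≤ C ∧ ∀ l : ℝ, 1 ≤ |l| →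
    ‖sinOsc l (-(π / 2)) (π / 2) (fun x => Real.cos x ^ m)‖ ≤ C * (√|l|)⁻¹ ^ (m + 1) ∧
    ‖sinOsc l (-(π / 2)) (π / 2) (fun x => Real.cos x ^ m * Real.sin x)‖
      ≤ C * (√|l|)⁻¹ ^ (m + 1) := by
  have hsq : ∀ l : ℝ, |l|⁻¹ = (√|l|)⁻¹ ^ 2 := fun l => by
    rw [inv_pow, Real.sq_sqrt (abs_nonneg l)]
  induction m using Nat.twoStepInduction with
  | zero =>
    refine ⟨2 + 2 * π, by positivity, fun l hl => ?_⟩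
    simp only [pow_zero, one_mul, zero_add, pow_one]
    constructor
    · refine norm_sinOsc_le_inv_sqrt hl (w' := fun _ => 0) (fun x => hasDerivAt_const x 1)
        continuous_const (by simp) fun x => ?_
      simpa using Real.abs_sin_le_one x
    · refine norm_sinOsc_le_inv_sqrt hl (w' := Real.cos) (fun x => Real.hasDerivAt_sin x)
        Real.continuous_cos Real.abs_sin_le_one fun x => ?_
      have : Real.cos x * Real.cos x + Real.sin x * Real.sin x = 1 := by
        nlinarith [Real.sin_sq_add_cos_sq x]
      simp [this]
  | one =>
    refine ⟨2 + π, by positivity, fun l hl => ?_⟩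
    have hl0 : l ≠ 0 := by rintro rfl; norm_num at hl
    have hi : 0 ≤ |l|⁻¹ := by positivity
    have hpi := Real.pi_pos
    simp only [pow_one]
    rw [show 1 + 1 = 2 from rfl, ← hsq]
    constructor
    · have := norm_sinOsc_cos_mul_le hl0 (a := -(π / 2)) (b := π / 2) (u := fun _ => 1)
        (u' := fun _ => 0) (fun x _ => hasDerivAt_const x 1) continuousOn_const
      have h0 : sinOsc l (-(π / 2)) (π / 2) (fun _ => 0) = 0 := by simp [sinOsc]
      simp only [mul_one, h0] at this
      refine this.trans ?_
      simp only [abs_one, norm_zero]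
      nlinarith
    · have := norm_sinOsc_cos_mul_le hl0 (a := -(π / 2)) (b := π / 2) (u := Real.sin)
        (u' := Real.cos) (fun x _ => Real.hasDerivAt_sin x) Real.continuous_cos.continuousOn
      have h0 : ‖sinOsc l (-(π / 2)) (π / 2) Real.cos‖ ≤ π := by
        refine (norm_sinOsc_le (g := fun _ => 1) (by linarith)
          (fun x _ => Real.abs_cos_le_one x) (by simp)).trans ?_
        simp
      refine this.trans ?_
      rw [mul_comm (2 + π)]
      gcongr
      linarith [Real.abs_sin_le_one (π / 2), Real.abs_sin_le_one (-(π / 2))]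
  | more m ih _ =>
    obtain ⟨C, hC, h⟩ := ih
    refine ⟨(m + 1) * C + ((m + 2) * ((m + 1) * C) + (m + 1) * C), by positivity, fun l hl => ?_⟩
    have hl0 : l ≠ 0 := by rintro rfl; norm_num at hl
    obtain ⟨hA, hB⟩ := h l hl
    set s := (√|l|)⁻¹ with hs
    have hs0 : 0 ≤ s := by positivity
    have hs1 : s ≤ 1 := inv_le_one_of_one_le₀ (Real.one_le_sqrt.2 hl)
    have hA' : ‖sinOsc l (-(π / 2)) (π / 2) (fun x => Real.cos x ^ (m + 2))‖
        ≤ (m + 1) * C * s ^ (m + 2 + 1) := by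
      have := norm_sinOsc_cos_mul_le hl0 (a := -(π / 2)) (b := π / 2)
        (u := fun x => Real.cos x ^ (m + 1))
        (u' := fun x => (-(m + 1 : ℝ)) * (Real.cos x ^ m * Real.sin x))
        (fun x _ => by
          refine ((Real.hasDerivAt_cos x).pow (m + 1)).congr_deriv ?_
          push_cast
          ring)
        (by fun_prop)
      rw [sinOsc_const_mul, norm_mul, Complex.norm_real, Real.norm_eq_abs, abs_neg,
        abs_of_nonneg (by positivity : (0 : ℝ) ≤ m + 1)] at this
      simp only [Real.cos_neg, Real.cos_pi_div_two, zero_pow (Nat.succ_ne_zero m), abs_zero,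
        zero_add, ← pow_succ', hsq, ← hs, add_assoc] at this
      refine this.trans ?_
      calc _ ≤ s ^ 2 * ((m + 1) * (C * s ^ (m + 1))) := by gcongr
        _ = _ := by ring
    refine ⟨hA'.trans ?_, ?_⟩
    · gcongr
      have : 0 ≤ (m + 2 : ℝ) * ((m + 1) * C) + (m + 1) * C := by positivity
      linarith
    · have := norm_sinOsc_cos_mul_le hl0 (a := -(π / 2)) (b := π / 2)
        (u := fun x => Real.cos x ^ (m + 1) * Real.sin x)
        (u' := fun x => (m + 2 : ℝ) * Real.cos x ^ (m + 2) - (m + 1 : ℝ) * Real.cos x ^ m)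
        (fun x _ => by
          refine (((Real.hasDerivAt_cos x).pow (m + 1)).mul (Real.hasDerivAt_sin x)).congr_deriv ?_
          simp only [Pi.pow_apply, Nat.add_sub_cancel]
          push_cast
          linear_combination (-((m : ℝ) + 1)) * Real.cos x ^ m * Real.sin_sq_add_cos_sq x)
        (by fun_prop)
      rw [sinOsc_sub (by fun_prop) (by fun_prop), sinOsc_const_mul, sinOsc_const_mul] at this
      simp only [Real.cos_neg, Real.cos_pi_div_two, zero_pow (Nat.succ_ne_zero m), abs_zero,
        zero_add, zero_mul, ← mul_assoc, ← pow_succ', hsq, ← hs, add_assoc] at this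
      refine this.trans ?_
      have e1 : ‖((m + 2 : ℝ) : ℂ)‖ = m + 2 := by
        rw [Complex.norm_real, Real.norm_eq_abs, abs_of_nonneg (by positivity)]
      have e2 : ‖((m + 1 : ℝ) : ℂ)‖ = m + 1 := by
        rw [Complex.norm_real, Real.norm_eq_abs, abs_of_nonneg (by positivity)]
      calc _ ≤ s ^ 2 * ((m + 2) * ((m + 1) * C * s ^ (m + 2 + 1)) +
            (m + 1) * (C * s ^ (m + 1))) := by
            gcongr
            refine (norm_sub_le _ _).trans ?_
            rw [norm_mul, norm_mul, e1, e2]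
            gcongr
        _ ≤ s ^ 2 * ((m + 2) * ((m + 1) * C * s ^ (m + 1)) +
            (m + 1) * (C * s ^ (m + 1))) := by
            have := pow_le_pow_of_le_one hs0 hs1 (show m + 1 ≤ m + 2 + 1 by omega)
            gcongr
        _ = ((m + 2) * ((m + 1) * C) + (m + 1) * C) * s ^ (m + 2 + 1) := by ring
        _ ≤ _ := by
            refine mul_le_mul_of_nonneg_right ?_ (by positivity)
            exact le_add_of_nonneg_left (mul_nonneg (by positivity) hC)

lemma hausdorffMeasure_sphere_lt_top (m : ℕ) :
    μH[(m : ℝ)] (Metric.sphere (0 : EuclideanSpace ℝ (Fin (m + 1))) 1) < ⊤ := by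
  let g : Fin (m + 1) → ℝ → (Fin m → ℝ) → EuclideanSpace ℝ (Fin (m + 1)) :=
    fun i s y => WithLp.toLp 2 (i.insertNth s y)
  let F : Fin (m + 1) → ℝ → (Fin m → ℝ) → EuclideanSpace ℝ (Fin (m + 1)) :=
    fun i s y => ‖g i s y‖⁻¹ • g i s y
  let Q : Set (Fin m → ℝ) := Set.univ.pi fun _ => Set.Icc (-1) 1
  have hQ : IsCompact Q := isCompact_univ_pi fun _ => isCompact_Icc
  have hF : ∀ i, ∀ s ∈ ({1, -1} : Finset ℝ), μH[(m : ℝ)] (F i s '' Q) < ⊤ := by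
    intro i s hs
    have hs0 : s ≠ 0 := by
      rintro rfl; simp at hs
    have hg0 : ∀ y, g i s y ≠ 0 := by
      intro y hy
      have := congrArg (fun v : EuclideanSpace ℝ (Fin (m + 1)) => v i) hy
      simp [g] at this
      exact hs0 this
    have hg : ContDiff ℝ 1 (g i s) := by
      rw [contDiff_euclidean, Fin.forall_iff_succAbove i]
      refine ⟨?_, fun j => ?_⟩
      · simpa [g] using! contDiff_const
      · simpa [g] using! contDiff_apply ℝ ℝ j
    have hFc : ContDiff ℝ 1 (F i s) :=
      ((hg.norm ℝ hg0).inv fun y => norm_ne_zero_iff.2 (hg0 y)).smul hg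
    obtain ⟨K, hK⟩ := (hFc.locallyLipschitz.locallyLipschitzOn
      (s := Q)).exists_lipschitzOnWith_of_compact hQ
    refine (hK.hausdorffMeasure_image_le (by positivity : (0 : ℝ) ≤ m)).trans_lt ?_
    have hv := hausdorffMeasure_pi_real (ι := Fin m)
    rw [Fintype.card_fin] at hv
    rw [hv]
    exact ENNReal.mul_lt_top (by simp) hQ.measure_lt_top
  have hsub : Metric.sphere (0 : EuclideanSpace ℝ (Fin (m + 1))) 1 ⊆
      ⋃ i ∈ (Finset.univ : Finset (Fin (m + 1))), ⋃ s ∈ ({1, -1} : Finset ℝ), F i s '' Q := by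
    intro x hx
    have hx1 : ‖x‖ = 1 := by simpa using hx
    obtain ⟨i, -, hi⟩ := Finset.exists_max_image (Finset.univ : Finset (Fin (m + 1)))
      (fun i => |x i|) Finset.univ_nonempty
    have hxi : 0 < |x i| := by
      by_contra h
      have : x = 0 := by
        ext j
        have := hi j (Finset.mem_univ j)
        have h0 : |x j| ≤ 0 := this.trans (not_lt.1 h)
        simpa using h0
      rw [this, norm_zero] at hx1
      norm_num at hx1
    simp only [Set.mem_iUnion]
    refine ⟨i, Finset.mem_univ i, x i / |x i|, ?_, fun j => x (i.succAbove j) / |x i|, ?_, ?_⟩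
    · rcases abs_choice (x i) with h | h <;> rw [h] at hxi ⊢
      · simp [hxi.ne']
      · simp [(neg_pos.1 hxi).ne]
    · intro j _
      rw [Set.mem_Icc, ← abs_le, abs_div, abs_abs, div_le_one hxi]
      exact hi _ (Finset.mem_univ _)
    · have hgx : g i (x i / |x i|) (fun j => x (i.succAbove j) / |x i|) = |x i|⁻¹ • x := by
        ext k
        revert k
        rw [Fin.forall_iff_succAbove i]
        simp [g, div_eq_inv_mul]
      simp only [F, hgx, norm_smul, norm_inv, norm_abs_eq_norm, hx1, smul_smul]
      rw [Real.norm_eq_abs, mul_one, inv_inv, mul_inv_cancel₀ hxi.ne', one_smul]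
  refine (measure_mono hsub).trans_lt ?_
  refine (measure_biUnion_finset_le _ _).trans_lt (ENNReal.sum_lt_top.2 fun i _ => ?_)
  exact (measure_biUnion_finset_le _ _).trans_lt (ENNReal.sum_lt_top.2 fun s hs => hF i s hs)

/-- The trilinear form of Young's convolution inequality with two equal functions. -/
lemma lintegral_mul_mul_sub_le {E : Type*} [NormedAddCommGroup E] [MeasurableSpace E]
    [BorelSpace E] [SecondCountableTopology E] (μ : Measure E) [SFinite μ]
    [μ.IsAddLeftInvariant] [μ.IsNegInvariant]
    {f K : E → ENNReal} (hf : Measurable f) (hK : Measurable K) {p θ : ℝ}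
    (hp : 1 < p) (hθ : θ = 1 - 1 / p) (hθ2 : θ ≤ 1 / 2) :
    ∫⁻ z : E × E, f z.1 * f z.2 * K (z.1 - z.2) ∂(μ.prod μ) ≤
      (∫⁻ x, f x ^ p ∂μ) ^ (2 / p) * (∫⁻ x, K x ^ (1 / (2 * θ)) ∂μ) ^ (2 * θ) := by
  have hp0 : 0 < p := by linarith
  have hθ0 : 0 < θ := by
    rw [hθ, sub_pos, div_lt_one hp0]; exact hp
  set r := 1 / (2 * θ) with hr
  have hr0 : 0 < r := by positivity
  have hrθ : r * θ = 1 / 2 := by rw [hr]; field_simp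
  have hpθ : p * θ = p - 1 := by rw [hθ]; field_simp
  have : μ.IsAddRightInvariant := ⟨fun g => by
    simpa [add_comm] using map_add_left_eq_self μ g⟩
  set I := ∫⁻ x, f x ^ p ∂μ with hI
  set J := ∫⁻ x, K x ^ r ∂μ with hJ
  let F : Fin 3 → E × E → ENNReal := ![fun z => f z.1 ^ p * K (z.1 - z.2) ^ r,
    fun z => f z.2 ^ p * K (z.1 - z.2) ^ r, fun z => f z.1 ^ p * f z.2 ^ p]
  have hF : ∀ i ∈ (Finset.univ : Finset (Fin 3)), AEMeasurable (F i) (μ.prod μ) := by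
    intro i _
    refine Measurable.aemeasurable ?_
    revert i
    simp only [Fin.forall_fin_succ, F, Finset.mem_univ, true_implies]
    refine ⟨?_, ?_, ?_, fun i => i.elim0⟩
    · change Measurable fun z : E × E => f z.1 ^ p * K (z.1 - z.2) ^ r
      fun_prop
    · change Measurable fun z : E × E => f z.2 ^ p * K (z.1 - z.2) ^ r
      fun_prop
    · change Measurable fun z : E × E => f z.1 ^ p * f z.2 ^ p
      fun_prop
  have key := ENNReal.lintegral_prod_norm_pow_le (Finset.univ : Finset (Fin 3)) hF
    (p := ![θ, θ, 1 - 2 * θ]) (by simp [Fin.sum_univ_three]; ring) (by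
      intro i _; fin_cases i <;> simp <;> linarith)
  simp only [Fin.prod_univ_three, F, Matrix.cons_val_zero, Matrix.cons_val_one,
    Matrix.cons_val] at key
  have h1 : ∫⁻ z, f z.1 ^ p * K (z.1 - z.2) ^ r ∂(μ.prod μ) = I * J := by
    rw [lintegral_prod _ (Measurable.aemeasurable (by fun_prop)), hI,
      ← lintegral_mul_const _ (by fun_prop)]
    refine lintegral_congr fun x => ?_
    simp only
    rw [lintegral_const_mul _ (by fun_prop),
      lintegral_sub_left_eq_self (fun y => K y ^ r) x]
  have h2 : ∫⁻ z, f z.2 ^ p * K (z.1 - z.2) ^ r ∂(μ.prod μ) = I * J := by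
    rw [lintegral_prod_symm _ (Measurable.aemeasurable (by fun_prop)), hI,
      ← lintegral_mul_const _ (by fun_prop)]
    refine lintegral_congr fun x => ?_
    simp only
    rw [lintegral_const_mul _ (by fun_prop),
      lintegral_sub_right_eq_self (fun y => K y ^ r) x]
  have h3 : ∫⁻ z, f z.1 ^ p * f z.2 ^ p ∂(μ.prod μ) = I * I :=
    lintegral_prod_mul (hf.pow_const p).aemeasurable (hf.pow_const p).aemeasurable
  rw [h1, h2, h3] at key
  have hθ3 : 0 ≤ 1 - 2 * θ := by linarith
  have hpt : ∀ a b k : ENNReal, (a ^ p * k ^ r) ^ θ * (b ^ p * k ^ r) ^ θ *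
      (a ^ p * b ^ p) ^ (1 - 2 * θ) = a * b * k := by
    intro a b k
    have ha : ∀ a : ENNReal, a ^ (p * θ) * a ^ (p * (1 - 2 * θ)) = a := fun a => by
      rw [← ENNReal.rpow_add_of_nonneg _ _ (by positivity) (by positivity)]
      rw [show p * θ + p * (1 - 2 * θ) = 1 by linarith, ENNReal.rpow_one]
    have hk : k ^ (r * θ) * k ^ (r * θ) = k := by
      rw [← ENNReal.rpow_add_of_nonneg _ _ (by positivity) (by positivity), hrθ]
      norm_num
    simp only [ENNReal.mul_rpow_of_nonneg _ _ hθ0.le, ENNReal.mul_rpow_of_nonneg _ _ hθ3,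
      ← ENNReal.rpow_mul]
    calc _ = (a ^ (p * θ) * a ^ (p * (1 - 2 * θ))) * (b ^ (p * θ) * b ^ (p * (1 - 2 * θ))) *
          (k ^ (r * θ) * k ^ (r * θ)) := by ring
      _ = _ := by rw [ha, ha, hk]
  simp only [hpt] at key
  refine key.trans (le_of_eq ?_)
  rw [← ENNReal.rpow_add_of_nonneg _ _ hθ0.le hθ0.le, ENNReal.mul_rpow_of_nonneg _ _ (by positivity),
    ENNReal.mul_rpow_of_nonneg _ _ hθ3, ← ENNReal.rpow_add_of_nonneg _ _ hθ3 hθ3, ← two_mul,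
    mul_right_comm, ← ENNReal.rpow_add_of_nonneg _ _ (by positivity) (by positivity)]
  congr 2
  rw [hθ]; field_simp; ring

lemma integral_comp_arctan_cos_pow (l : ℝ) (m : ℕ) :
    ∫ s : ℝ, Complex.exp ((l * (s / √(1 + s ^ 2)) : ℝ) * Complex.I) *
      (((√(1 + s ^ 2))⁻¹ ^ (m + 2) : ℝ) : ℂ) =
    sinOsc l (-(π / 2)) (π / 2) (fun x => Real.cos x ^ m) := by
  have h := integral_image_eq_integral_abs_deriv_smul (s := Set.univ) (f := Real.arctan)
    MeasurableSet.univ (fun x _ => (Real.hasDerivAt_arctan x).hasDerivWithinAt)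
    Real.arctan_injective.injOn
    (fun x => Complex.exp ((l * Real.sin x : ℝ) * Complex.I) * ((Real.cos x ^ m : ℝ) : ℂ))
  rw [Set.image_univ, Real.range_arctan, setIntegral_univ] at h
  rw [sinOsc, intervalIntegral.integral_of_le (by linarith [Real.pi_pos]),
    integral_Ioc_eq_integral_Ioo, h]
  congr 1; ext s
  have h0 : 0 < 1 + s ^ 2 := by positivity
  rw [Real.sin_arctan, Real.cos_arctan, abs_of_pos (by positivity), Complex.real_smul, pow_add,
    one_div, one_div, inv_pow _ 2, Real.sq_sqrt h0.le]
  push_cast; ring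

/-- The integral of a zonal oscillating function against the Gaussian weight reduces to a
one-dimensional oscillatory integral. -/
lemma integral_zonal_gaussian (m : ℕ) : ∃ c : ℝ, ∀ l : ℝ,
    ∫ x : EuclideanSpace ℝ (Fin (m + 2)),
      Complex.exp ((l * (x 0 / ‖x‖) : ℝ) * Complex.I) * ((Real.exp (-‖x‖ ^ 2) : ℝ) : ℂ) =
    c * sinOsc l (-(π / 2)) (π / 2) (fun x => Real.cos x ^ m) := by
  let q : (Fin (m + 1) → ℝ) → ℝ := fun y => ∑ i, y i ^ 2
  have hq0 : ∀ y, 0 ≤ q y := fun y => Finset.sum_nonneg fun i _ => sq_nonneg _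
  have hqc : Continuous q := by fun_prop
  refine ⟨∫ y, √(q y) * Real.exp (-q y), fun l => ?_⟩
  let G : EuclideanSpace ℝ (Fin (m + 2)) → ℂ := fun x =>
    Complex.exp ((l * (x 0 / ‖x‖) : ℝ) * Complex.I) * ((Real.exp (-‖x‖ ^ 2) : ℝ) : ℂ)
  let H : ℝ × (Fin (m + 1) → ℝ) → ℂ := fun z =>
    Complex.exp ((l * (z.1 / √(z.1 ^ 2 + q z.2)) : ℝ) * Complex.I) *
      ((Real.exp (-(z.1 ^ 2 + q z.2)) : ℝ) : ℂ)
  let e : EuclideanSpace ℝ (Fin (m + 2)) ≃ᵐ ℝ × (Fin (m + 1) → ℝ) :=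
    (MeasurableEquiv.toLp 2 (Fin (m + 2) → ℝ)).symm.trans
      (MeasurableEquiv.piFinSuccAbove (fun _ => ℝ) 0)
  have he : MeasurePreserving e volume volume :=
    (volume_preserving_piFinSuccAbove (fun _ : Fin (m + 2) => ℝ) 0).comp
      (PiLp.volume_preserving_ofLp (Fin (m + 2)))
  have hGH : ∀ x, H (e x) = G x := by
    intro x
    have hn : (e x).1 ^ 2 + q (e x).2 = ‖x‖ ^ 2 := by
      rw [EuclideanSpace.norm_sq_eq, Fin.sum_univ_succ]
      simp [e, q, MeasurableEquiv.piFinSuccAbove, Fin.insertNthEquiv]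
      rfl
    have h1 : (e x).1 = x 0 := rfl
    simp only [H, G]
    rw [hn, h1, Real.sqrt_sq (norm_nonneg x)]
  have hGint : Integrable G := by
    have hg := (GaussianFourier.integrable_cexp_neg_mul_sq_norm_add (b := 1) (by simp) 0
      (0 : EuclideanSpace ℝ (Fin (m + 2)))).norm
    refine hg.mono' (Measurable.aestronglyMeasurable (by fun_prop))
      (Filter.Eventually.of_forall fun x => le_of_eq ?_)
    simp only [G]
    rw [norm_mul, Complex.norm_exp_ofReal_mul_I, one_mul, Complex.norm_real, Complex.norm_exp,
      Real.norm_eq_abs, Real.abs_exp]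
    congr 1
    simp [← Complex.ofReal_pow]
  have hHint : Integrable H := by
    rw [← he.integrable_comp_emb e.measurableEmbedding]
    exact hGint.congr (Filter.Eventually.of_forall fun x => (hGH x).symm)
  let M : ℝ × (Fin (m + 1) → ℝ) → ℂ := fun z =>
    Complex.exp ((l * (z.1 / √(1 + z.1 ^ 2)) : ℝ) * Complex.I) *
      ((√(q z.2) * Real.exp (-(q z.2 * (1 + z.1 ^ 2))) : ℝ) : ℂ)
  have hMH : ∀ y, 0 < q y → ∀ s, M (s, y) = √(q y) • H (√(q y) * s, y) := by
    intro y hy s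
    have h1 : (√(q y) * s) ^ 2 + q y = q y * (1 + s ^ 2) := by
      rw [mul_pow, Real.sq_sqrt hy.le]; ring
    have h2 : √(q y) * s / (√(q y) * √(1 + s ^ 2)) = s / √(1 + s ^ 2) :=
      mul_div_mul_left _ _ (Real.sqrt_pos.2 hy).ne'
    simp only [M, H, h1, Real.sqrt_mul hy.le, h2, Complex.real_smul]
    push_cast; ring
  have hqpos : ∀ᵐ y : Fin (m + 1) → ℝ, 0 < q y := by
    have : ∀ᵐ y : Fin (m + 1) → ℝ, y ≠ 0 := by
      rw [ae_iff]; simp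
    filter_upwards [this] with y hy
    obtain ⟨i, hi⟩ := Function.ne_iff.1 hy
    exact Finset.sum_pos' (fun i _ => sq_nonneg _) ⟨i, Finset.mem_univ i, by
      have : y i ≠ 0 := hi
      positivity⟩
  have hscale : ∀ (y : Fin (m + 1) → ℝ), 0 < q y → ∀ {F : Type} [NormedAddCommGroup F]
      [NormedSpace ℝ F] (h : ℝ → F), √(q y) • ∫ s, h (√(q y) * s) = ∫ t, h t := by
    intro y hy F _ _ h
    have := Real.sqrt_pos.2 hy
    rw [Measure.integral_comp_mul_left, abs_of_pos (by positivity), smul_smul,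
      mul_inv_cancel₀ this.ne', one_smul]
  have hMH' : ∀ y, 0 < q y → ∫ s, M (s, y) = ∫ t, H (t, y) := by
    intro y hy
    simp only [hMH y hy]
    rw [integral_smul, hscale y hy (fun t => H (t, y))]
  have hMHn : ∀ y, 0 < q y → ∫ s, ‖M (s, y)‖ = ∫ t, ‖H (t, y)‖ := by
    intro y hy
    simp only [hMH y hy, norm_smul, norm_of_nonneg (Real.sqrt_nonneg (q y))]
    rw [integral_const_mul, ← smul_eq_mul, hscale y hy (fun t => ‖H (t, y)‖)]
  have hHint' : Integrable H (volume.prod volume) := hHint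
  have hMint : Integrable M (volume.prod volume) := by
    rw [integrable_prod_iff' (Measurable.aestronglyMeasurable (by fun_prop))]
    obtain ⟨h1, h2⟩ := (integrable_prod_iff' hHint'.1).1 hHint'
    constructor
    · filter_upwards [h1, hqpos] with y hy hqy
      simp only [hMH y hqy]
      exact (hy.comp_mul_left' (Real.sqrt_pos.2 hqy).ne').smul (√(q y))
    · refine h2.congr ?_
      filter_upwards [hqpos] with y hqy using (hMHn y hqy).symm
  have hy_int : ∀ s : ℝ, ∫ y, √(q y) * Real.exp (-(q y * (1 + s ^ 2))) =
      (√(1 + s ^ 2))⁻¹ ^ (m + 2) * ∫ y, √(q y) * Real.exp (-q y) := by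
    intro s
    set R := √(1 + s ^ 2) with hR
    have hR0 : 0 < R := Real.sqrt_pos.2 (by positivity)
    have hRs : R ^ 2 = 1 + s ^ 2 := Real.sq_sqrt (by positivity)
    have hqR : ∀ y, q (R • y) = R ^ 2 * q y := by
      intro y
      simp only [q, Pi.smul_apply, smul_eq_mul, mul_pow, Finset.mul_sum]
    have := Measure.integral_comp_smul (volume : Measure (Fin (m + 1) → ℝ))
      (fun y => √(q y) * Real.exp (-q y)) R
    simp only [hqR, Real.sqrt_mul (sq_nonneg R), Real.sqrt_sq hR0.le, mul_assoc] at this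
    rw [integral_const_mul, Module.finrank_fin_fun, abs_of_pos (by positivity), smul_eq_mul] at this
    simp only [← hRs, mul_comm (q _) (R ^ 2)]
    rw [← eq_inv_mul_iff_mul_eq₀ hR0.ne'] at this
    rw [this]
    ring
  calc ∫ x, G x = ∫ z, H z := by
        rw [← he.integral_comp e.measurableEmbedding]
        simp only [hGH]
    _ = ∫ y, ∫ t, H (t, y) := integral_prod_symm _ hHint'
    _ = ∫ y, ∫ s, M (s, y) := by
        refine integral_congr_ae ?_
        filter_upwards [hqpos] with y hqy using (hMH' y hqy).symm
    _ = ∫ s, ∫ y, M (s, y) := (integral_integral_swap (f := fun s y => M (s, y)) hMint).symm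
    _ = ∫ s : ℝ, ((∫ y, √(q y) * Real.exp (-q y) : ℝ) : ℂ) *
          (Complex.exp ((l * (s / √(1 + s ^ 2)) : ℝ) * Complex.I) *
          (((√(1 + s ^ 2))⁻¹ ^ (m + 2) : ℝ) : ℂ)) := by
        congr 1; ext s
        simp only [M]
        rw [integral_const_mul, integral_complex_ofReal, hy_int s]
        push_cast; ring
    _ = _ := by rw [integral_const_mul, integral_comp_arctan_cos_pow]

lemma exists_linearIsometryEquiv_map_eq {F : Type*} [NormedAddCommGroup F]
    [InnerProductSpace ℝ F] {v w : F} (h : ‖v‖ = ‖w‖) : ∃ R : F ≃ₗᵢ[ℝ] F, R v = w :=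
  ⟨(ℝ ∙ (v - w))ᗮ.reflection, Submodule.reflection_sub h⟩

/-- The Fourier transform of a measure. -/
def fourierMeasure {F : Type*} [NormedAddCommGroup F] [InnerProductSpace ℝ F]
    [MeasurableSpace F] (σ : Measure F) (y : F) : ℂ :=
  ∫ ξ, Complex.exp ((-2 * π * inner ℝ y ξ : ℝ) * Complex.I) ∂σ

lemma norm_fourierMeasure_le {F : Type*} [NormedAddCommGroup F] [InnerProductSpace ℝ F]
    [MeasurableSpace F] (σ : Measure F) (y : F) : ‖fourierMeasure σ y‖ ≤ σ.real Set.univ := by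
  refine (norm_integral_le_integral_norm _).trans (le_of_eq ?_)
  simp only [Complex.norm_exp_ofReal_mul_I]
  simp

lemma fourierMeasure_eq_of_norm_eq {F : Type*} [NormedAddCommGroup F] [InnerProductSpace ℝ F]
    [MeasurableSpace F] [BorelSpace F] {σ : Measure F}
    (hσ : ∀ R : F ≃ₗᵢ[ℝ] F, MeasurePreserving R σ σ) {x y : F} (h : ‖x‖ = ‖y‖) :
    fourierMeasure σ x = fourierMeasure σ y := by
  obtain ⟨R, rfl⟩ := exists_linearIsometryEquiv_map_eq h
  rw [fourierMeasure, fourierMeasure,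
    ← (hσ R).integral_comp R.toHomeomorph.measurableEmbedding
      (fun ξ => Complex.exp ((-2 * π * inner ℝ (R x) ξ : ℝ) * Complex.I))]
  simp only [LinearIsometryEquiv.inner_map_map]

lemma integral_zonal_gaussian_inner (m : ℕ) : ∃ c : ℝ, ∀ l : ℝ,
    ∀ ξ : EuclideanSpace ℝ (Fin (m + 2)), ‖ξ‖ = 1 →
    ∫ x, Complex.exp ((l * (inner ℝ x ξ / ‖x‖) : ℝ) * Complex.I) *
      ((Real.exp (-‖x‖ ^ 2) : ℝ) : ℂ) =
    c * sinOsc l (-(π / 2)) (π / 2) (fun x => Real.cos x ^ m) := by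
  obtain ⟨c, hc⟩ := integral_zonal_gaussian m
  refine ⟨c, fun l ξ hξ => ?_⟩
  obtain ⟨R, rfl⟩ := exists_linearIsometryEquiv_map_eq
    (v := EuclideanSpace.single (0 : Fin (m + 2)) (1 : ℝ)) (w := ξ) (by simp [hξ])
  rw [← hc l, ← R.measurePreserving.integral_comp R.toHomeomorph.measurableEmbedding]
  simp only [LinearIsometryEquiv.inner_map_map, LinearIsometryEquiv.norm_map]
  simp [EuclideanSpace.inner_single_right]

lemma fourierMeasure_eq_mul_sinOsc (m : ℕ) : ∃ c : ℝ,
    ∀ (σ : Measure (EuclideanSpace ℝ (Fin (m + 2)))) [IsFiniteMeasure σ],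
    (∀ R : EuclideanSpace ℝ (Fin (m + 2)) ≃ₗᵢ[ℝ] EuclideanSpace ℝ (Fin (m + 2)),
      MeasurePreserving R σ σ) → (∀ᵐ ξ ∂σ, ‖ξ‖ = 1) → ∀ y,
    fourierMeasure σ y = σ.real Set.univ * c *
      sinOsc (-2 * π * ‖y‖) (-(π / 2)) (π / 2) (fun x => Real.cos x ^ m) := by
  obtain ⟨c, hc⟩ := integral_zonal_gaussian_inner m
  set G := ∫ x : EuclideanSpace ℝ (Fin (m + 2)), Real.exp (-‖x‖ ^ 2) with hG
  have hint : Integrable fun x : EuclideanSpace ℝ (Fin (m + 2)) => Real.exp (-‖x‖ ^ 2) := by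
    have hg := (GaussianFourier.integrable_cexp_neg_mul_sq_norm_add (b := 1) (by simp) 0
      (0 : EuclideanSpace ℝ (Fin (m + 2)))).norm
    refine hg.congr (Filter.Eventually.of_forall fun x => ?_)
    simp [Complex.norm_exp, ← Complex.ofReal_pow]
  have hG0 : 0 < G := by
    refine (integral_pos_iff_support_of_nonneg (fun x => (Real.exp_pos _).le) hint).2 ?_
    have : Function.support (fun x : EuclideanSpace ℝ (Fin (m + 2)) => Real.exp (-‖x‖ ^ 2)) =
        Set.univ := by
      ext x; simp
    rw [this]
    simp
  refine ⟨c / G, fun σ _ hσ hs y => ?_⟩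
  let A : EuclideanSpace ℝ (Fin (m + 2)) → EuclideanSpace ℝ (Fin (m + 2)) → ℂ := fun x ξ =>
    Complex.exp ((-2 * π * ‖y‖ * (inner ℝ x ξ / ‖x‖) : ℝ) * Complex.I) *
      ((Real.exp (-‖x‖ ^ 2) : ℝ) : ℂ)
  have hA : Integrable (Function.uncurry A) (volume.prod σ) := by
    refine (hint.comp_fst σ).mono' (Measurable.aestronglyMeasurable ?_)
      (Filter.Eventually.of_forall fun z => le_of_eq ?_)
    · simp only [A, Function.uncurry_def]
      fun_prop
    · simp only [A, Function.uncurry_def]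
      rw [norm_mul, Complex.norm_exp_ofReal_mul_I, one_mul, Complex.norm_real,
        Real.norm_eq_abs, Real.abs_exp]
  have h1 : (G : ℂ) * fourierMeasure σ y = ∫ x, ∫ ξ, A x ξ ∂σ := by
    rw [hG, ← integral_complex_ofReal, ← integral_mul_const]
    refine integral_congr_ae ?_
    have : ∀ᵐ x : EuclideanSpace ℝ (Fin (m + 2)), x ≠ 0 := by
      rw [ae_iff]; simp
    filter_upwards [this] with x hx
    have hx' : ‖x‖ ≠ 0 := norm_ne_zero_iff.2 hx
    have hxy : ‖y‖ = ‖(‖y‖ / ‖x‖) • x‖ := by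
      rw [norm_smul, Real.norm_of_nonneg (by positivity), div_mul_cancel₀ _ hx']
    rw [fourierMeasure_eq_of_norm_eq hσ hxy, fourierMeasure, ← integral_const_mul]
    congr 1; ext ξ
    simp only [A]
    rw [mul_comm, real_inner_smul_left]
    congr 4
    ring
  have h2 : ∫ x, ∫ ξ, A x ξ ∂σ = σ.real Set.univ * (c *
      sinOsc (-2 * π * ‖y‖) (-(π / 2)) (π / 2) (fun x => Real.cos x ^ m)) := by
    rw [integral_integral_swap hA]
    have : ∀ᵐ ξ ∂σ, ∫ x, A x ξ = c *
        sinOsc (-2 * π * ‖y‖) (-(π / 2)) (π / 2) (fun x => Real.cos x ^ m) := by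
      filter_upwards [hs] with ξ hξ using hc _ ξ hξ
    rw [integral_congr_ae this, integral_const, Complex.real_smul]
  have hGc : (G : ℂ) ≠ 0 := by exact_mod_cast hG0.ne'
  rw [h2] at h1
  push_cast
  refine mul_left_cancel₀ hGc (h1.trans ?_)
  field_simp

/-- Decay of the Fourier transform of a rotation-invariant measure on the sphere. -/
lemma fourierMeasure_decay (m : ℕ) (σ : Measure (EuclideanSpace ℝ (Fin (m + 2))))
    [IsFiniteMeasure σ]
    (hσ : ∀ R : EuclideanSpace ℝ (Fin (m + 2)) ≃ₗᵢ[ℝ] EuclideanSpace ℝ (Fin (m + 2)),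
      MeasurePreserving R σ σ) (hs : ∀ᵐ ξ ∂σ, ‖ξ‖ = 1) :
    ∃ C, 0 ≤ C ∧ ∀ y, ‖fourierMeasure σ y‖ ≤ C * (√(1 + ‖y‖))⁻¹ ^ (m + 1) := by
  obtain ⟨c, hc⟩ := fourierMeasure_eq_mul_sinOsc m
  obtain ⟨D, hD0, hD⟩ := sinOsc_cos_pow_decay m
  set s := σ.real Set.univ with hsdef
  have hs0 : 0 ≤ s := measureReal_nonneg
  refine ⟨(s + s * |c| * D) * √2 ^ (m + 1), by positivity, fun y => ?_⟩
  have hR : 0 < √(1 + ‖y‖) := Real.sqrt_pos.2 (by positivity)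
  rw [mul_assoc, ← mul_pow, ← div_eq_mul_inv]
  rcases le_total 1 ‖y‖ with h | h
  · have hl : |(-2 * π * ‖y‖)| = 2 * π * ‖y‖ := by
      rw [abs_mul, abs_mul, abs_of_pos Real.pi_pos, abs_norm]; norm_num
    have hl1 : 1 + ‖y‖ ≤ 2 * (2 * π * ‖y‖) := by nlinarith [Real.pi_gt_three]
    have hl2 : 1 ≤ 2 * π * ‖y‖ := by nlinarith [Real.pi_gt_three]
    have h1 := (hD (-2 * π * ‖y‖) (by rw [hl]; exact hl2)).1
    rw [hl] at h1
    have h2 : (√(2 * π * ‖y‖))⁻¹ ≤ √2 / √(1 + ‖y‖) := by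
      rw [← Real.sqrt_div (by norm_num), ← Real.sqrt_inv]
      apply Real.sqrt_le_sqrt
      rw [inv_le_iff_one_le_mul₀ (by positivity), div_mul_eq_mul_div, le_div_iff₀ (by positivity)]
      linarith
    rw [hc σ hσ hs y, norm_mul, norm_mul, Complex.norm_real, Complex.norm_real, Real.norm_eq_abs,
      Real.norm_eq_abs, abs_of_nonneg hs0, add_mul]
    refine le_add_of_nonneg_of_le (by positivity) ?_
    rw [mul_assoc (s * |c|)]
    refine mul_le_mul_of_nonneg_left (h1.trans ?_) (by positivity)
    exact mul_le_mul_of_nonneg_left (pow_le_pow_left₀ (by positivity) h2 _) hD0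
  · have h2 : 1 ≤ √2 / √(1 + ‖y‖) := by
      rw [one_le_div hR]
      exact Real.sqrt_le_sqrt (by linarith)
    calc ‖fourierMeasure σ y‖ ≤ s := norm_fourierMeasure_le σ y
      _ ≤ (s + s * |c| * D) * 1 := by
        have : 0 ≤ s * |c| * D := by positivity
        linarith
      _ ≤ _ := mul_le_mul_of_nonneg_left (one_le_pow₀ h2) (by positivity)

lemma measurePreserving_hausdorffMeasure_restrict_sphere {F : Type*} [NormedAddCommGroup F]
    [NormedSpace ℝ F] [MeasurableSpace F] [BorelSpace F] (d : ℝ) (R : F ≃ₗᵢ[ℝ] F) :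
    MeasurePreserving R (μH[d].restrict (Metric.sphere (0 : F) 1))
      (μH[d].restrict (Metric.sphere (0 : F) 1)) := by
  have h := (R.toIsometryEquiv.measurePreserving_hausdorffMeasure d).restrict_preimage
    (s := Metric.sphere (0 : F) 1) Metric.isClosed_sphere.measurableSet
  have h2 : R.toIsometryEquiv ⁻¹' Metric.sphere (0 : F) 1 = Metric.sphere (0 : F) 1 := by
    ext x; simp
  rw [h2] at h
  exact h

section TTStar

variable {F : Type*} [NormedAddCommGroup F] [InnerProductSpace ℝ F] [FiniteDimensional ℝ F]
  [MeasurableSpace F] [BorelSpace F]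

/-- The `TT*` identity: the squared `L²(σ)` norm of `𝓕 f` as a double integral against the Fourier
transform of `σ`. -/
lemma integral_norm_fourier_sq (σ : Measure F) [IsFiniteMeasure σ] {f : F → ℂ}
    (hf : Integrable f) :
    ((∫ ξ, ‖𝓕 f ξ‖ ^ 2 ∂σ : ℝ) : ℂ) =
      ∫ z : F × F, f z.1 * (starRingEnd ℂ) (f z.2) * fourierMeasure σ (z.1 - z.2) := by
  let e : F → F → ℂ := fun x ξ => Complex.exp ((-2 * π * inner ℝ x ξ : ℝ) * Complex.I)
  have he : ∀ x y ξ, e x ξ * (starRingEnd ℂ) (e y ξ) = e (x - y) ξ := by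
    intro x y ξ
    simp only [e]
    rw [← Complex.exp_conj, ← Complex.exp_add, map_mul, Complex.conj_ofReal, Complex.conj_I,
      inner_sub_left]
    congr 1
    push_cast; ring
  have hF : ∀ ξ, 𝓕 f ξ = ∫ x, f x * e x ξ := by
    intro ξ
    rw [Real.fourier_eq']
    congr 1; ext x
    simp only [e, smul_eq_mul]
    rw [mul_comm]
  have hprod : Integrable (fun z : F × F => f z.1 * (starRingEnd ℂ) (f z.2))
      (volume.prod volume) :=
    hf.mul_prod (Complex.conjLIE.integrable_comp_iff.2 hf)
  have hsq : ∀ ξ, ((‖𝓕 f ξ‖ ^ 2 : ℝ) : ℂ) =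
      ∫ z : F × F, f z.1 * (starRingEnd ℂ) (f z.2) * e (z.1 - z.2) ξ := by
    intro ξ
    rw [Complex.ofReal_pow, ← Complex.mul_conj', hF, ← integral_conj, ← integral_prod_mul]
    congr 1; ext z
    rw [← he, map_mul]; ring
  have hint : Integrable (Function.uncurry fun (ξ : F) (z : F × F) =>
      f z.1 * (starRingEnd ℂ) (f z.2) * e (z.1 - z.2) ξ) (σ.prod (volume.prod volume)) := by
    refine (hprod.comp_snd σ).mul_bdd (c := 1) (Measurable.aestronglyMeasurable ?_)
      (Filter.Eventually.of_forall fun z => le_of_eq ?_)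
    · simp only [e]
      fun_prop
    · simp only [e]
      rw [Complex.norm_exp_ofReal_mul_I]
  rw [← integral_complex_ofReal]
  simp only [hsq]
  rw [Measure.volume_eq_prod, integral_integral_swap hint]
  simp only [integral_const_mul]
  rfl

lemma ofReal_integral_norm_fourier_sq_le (σ : Measure F) [IsFiniteMeasure σ] {f : F → ℂ}
    (hf : Integrable f) {K : F → ENNReal} (hK : ∀ y, ‖fourierMeasure σ y‖ₑ ≤ K y) :
    ENNReal.ofReal (∫ ξ, ‖𝓕 f ξ‖ ^ 2 ∂σ) ≤
      ∫⁻ z : F × F, ‖f z.1‖ₑ * ‖f z.2‖ₑ * K (z.1 - z.2) ∂(volume.prod volume) := by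
  have h0 : 0 ≤ ∫ ξ, ‖𝓕 f ξ‖ ^ 2 ∂σ := integral_nonneg fun _ => by positivity
  have h1 : ENNReal.ofReal (∫ ξ, ‖𝓕 f ξ‖ ^ 2 ∂σ) =
      ‖((∫ ξ, ‖𝓕 f ξ‖ ^ 2 ∂σ : ℝ) : ℂ)‖ₑ := by
    rw [← ofReal_norm, Complex.norm_real, Real.norm_of_nonneg h0]
  rw [h1, integral_norm_fourier_sq σ hf, Measure.volume_eq_prod]
  refine (enorm_integral_le_lintegral_enorm _).trans (lintegral_mono fun z => ?_)
  rw [enorm_mul, enorm_mul, RCLike.enorm_conj]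
  exact mul_le_mul_right (hK _) _

end TTStar

/-- A measure whose Fourier transform decays like `(1 + ‖y‖) ^ (-a)` satisfies the `L^p`-`L²`
Fourier restriction inequality as soon as `a` is large enough in terms of `p`. -/
lemma exists_restriction_bound {F : Type*} [NormedAddCommGroup F] [InnerProductSpace ℝ F]
    [FiniteDimensional ℝ F] [MeasurableSpace F] [BorelSpace F] (σ : Measure F)
    [IsFiniteMeasure σ] {C a p : ℝ} (hC : 0 ≤ C) (ha : 0 ≤ a)
    (hσ : ∀ y, ‖fourierMeasure σ y‖ ≤ C * (1 + ‖y‖) ^ (-a))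
    (hp : 1 ≤ p) (hp2 : 1 - 1 / p ≤ 1 / 2)
    (hpa : (Module.finrank ℝ F : ℝ) * (2 * (1 - 1 / p)) < a) :
    ∃ D : ENNReal, D ≠ ⊤ ∧ ∀ f : F → ℂ, Measurable f → Integrable f →
      ENNReal.ofReal (∫ ξ, ‖𝓕 f ξ‖ ^ 2 ∂σ) ≤ (∫⁻ x, ‖f x‖ₑ ^ p) ^ (2 / p) * D := by
  set K : F → ENNReal := fun y => ENNReal.ofReal (C * (1 + ‖y‖) ^ (-a)) with hKdef
  have hK : ∀ y, ‖fourierMeasure σ y‖ₑ ≤ K y := fun y => by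
    rw [← ofReal_norm]
    exact ENNReal.ofReal_le_ofReal (hσ y)
  have hKm : Measurable K := by
    simp only [hKdef]
    fun_prop
  rcases hp.eq_or_lt with rfl | hp1
  · refine ⟨ENNReal.ofReal C, ENNReal.ofReal_ne_top, fun f hfm hf => ?_⟩
    refine (ofReal_integral_norm_fourier_sq_le σ hf hK).trans ?_
    calc ∫⁻ z : F × F, ‖f z.1‖ₑ * ‖f z.2‖ₑ * K (z.1 - z.2) ∂(volume.prod volume)
        ≤ ∫⁻ z : F × F, ‖f z.1‖ₑ * ‖f z.2‖ₑ * ENNReal.ofReal C ∂(volume.prod volume) := by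
          refine lintegral_mono fun z => mul_le_mul_right (ENNReal.ofReal_le_ofReal ?_) _
          exact mul_le_of_le_one_right hC
            (Real.rpow_le_one_of_one_le_of_nonpos (by simp) (neg_nonpos.2 ha))
      _ = _ := by
          rw [lintegral_mul_const _ (by fun_prop),
            lintegral_prod_mul (f := fun x => ‖f x‖ₑ) (g := fun x => ‖f x‖ₑ) (by fun_prop)
              (by fun_prop)]
          simp only [ENNReal.rpow_one]
          norm_num
          rw [sq]
  · have hp0 : 0 < p := by linarith
    have hθ0 : 0 < 1 - 1 / p := by
      rw [sub_pos, div_lt_one hp0]; exact hp1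
    set r := 1 / (2 * (1 - 1 / p)) with hr
    have hr0 : 0 < r := by positivity
    refine ⟨(∫⁻ x, K x ^ r) ^ (2 * (1 - 1 / p)), ?_, fun f hfm hf => ?_⟩
    · refine ENNReal.rpow_ne_top_of_nonneg (by positivity) (ne_of_lt ?_)
      have hKr : ∀ x, K x ^ r =
          ENNReal.ofReal (C ^ r) * ENNReal.ofReal ((1 + ‖x‖) ^ (-(a * r))) := by
        intro x
        have h1 : 0 ≤ (1 + ‖x‖) ^ (-a) := by positivity
        simp only [hKdef]
        rw [ENNReal.ofReal_rpow_of_nonneg (by positivity) hr0.le, Real.mul_rpow hC h1,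
          ENNReal.ofReal_mul (by positivity), ← Real.rpow_mul (by positivity), neg_mul]
      simp only [hKr]
      rw [lintegral_const_mul _ (by fun_prop)]
      refine ENNReal.mul_lt_top ENNReal.ofReal_lt_top (finite_integral_one_add_norm ?_)
      rw [hr, mul_one_div, lt_div_iff₀ (by positivity)]
      exact hpa
    · refine (ofReal_integral_norm_fourier_sq_le σ hf hK).trans ?_
      exact lintegral_mul_mul_sub_le volume (f := fun x => ‖f x‖ₑ) (by fun_prop) hKm hp1 rfl hp2

/-- The squared form of the restriction estimate on the sphere. -/
lemma exists_sphere_restriction_sq_bound (m : ℕ) {p : ℝ} (hp : 1 ≤ p)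
    (hpm : p * (3 * m + 7) < 4 * (m + 2)) :
    ∃ D : ENNReal, D ≠ ⊤ ∧ ∀ f : EuclideanSpace ℝ (Fin (m + 2)) → ℂ, Measurable f → Integrable f →
      ENNReal.ofReal (∫ ξ in Metric.sphere (0 : EuclideanSpace ℝ (Fin (m + 2))) 1,
        ‖𝓕 f ξ‖ ^ 2 ∂(μH[((m + 1 : ℕ) : ℝ)])) ≤ (∫⁻ x, ‖f x‖ₑ ^ p) ^ (2 / p) * D := by
  have : IsFiniteMeasure ((μH[((m + 1 : ℕ) : ℝ)]).restrict
      (Metric.sphere (0 : EuclideanSpace ℝ (Fin (m + 2))) 1)) :=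
    isFiniteMeasure_restrict.2 (hausdorffMeasure_sphere_lt_top _).ne
  have hs : ∀ᵐ ξ ∂((μH[((m + 1 : ℕ) : ℝ)]).restrict
      (Metric.sphere (0 : EuclideanSpace ℝ (Fin (m + 2))) 1)), ‖ξ‖ = 1 := by
    filter_upwards [ae_restrict_mem Metric.isClosed_sphere.measurableSet] with ξ hξ
    exact mem_sphere_zero_iff_norm.1 hξ
  obtain ⟨C, hC0, hC⟩ := fourierMeasure_decay m _
    (measurePreserving_hausdorffMeasure_restrict_sphere _) hs
  have hdecay : ∀ y : EuclideanSpace ℝ (Fin (m + 2)),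
      (√(1 + ‖y‖))⁻¹ ^ (m + 1) = (1 + ‖y‖) ^ (-(((m : ℝ) + 1) / 2)) := by
    intro y
    rw [Real.sqrt_eq_rpow, ← Real.rpow_neg (by positivity), ← Real.rpow_natCast,
      ← Real.rpow_mul (by positivity)]
    congr 1
    push_cast; ring
  simp only [hdecay] at hC
  have hp0 : 0 < p := by linarith
  have hinv : (3 * m + 7) / (4 * ((m : ℝ) + 2)) < 1 / p := by
    rw [div_lt_div_iff₀ (by positivity) hp0]
    linarith
  have hlow : (3 : ℝ) / 4 ≤ (3 * m + 7) / (4 * ((m : ℝ) + 2)) := by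
    rw [div_le_div_iff₀ (by norm_num) (by positivity)]
    linarith
  refine exists_restriction_bound _ hC0 (by positivity) hC hp (by linarith) ?_
  rw [finrank_euclideanSpace_fin]
  rw [div_lt_iff₀ (by positivity)] at hinv
  push_cast
  linarith

/-- **First restriction theorem (Stein–Fefferman).** For `n ≥ 2` and
`1 ≤ p < 4n/(3n+1)`, the Fourier transform of a Schwartz function restricts to the
unit sphere with an `L²(σ)` bound in terms of the `Lᵖ(ℝⁿ)` norm. -/
theorem first_restriction_theorem (n : ℕ) (hn : 2 ≤ n) (p : ℝ) (hp1 : 1 ≤ p)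
    (hp2 : p < 4 * n / (3 * n + 1)) :
    ∃ C : ℝ, 0 < C ∧
      ∀ f : SchwartzMap (EuclideanSpace ℝ (Fin n)) ℂ,
        (∫ ξ in Metric.sphere (0 : EuclideanSpace ℝ (Fin n)) 1,
            ‖𝓕 (⇑f) ξ‖ ^ 2 ∂(μH[(n : ℝ) - 1])) ^ (1 / 2 : ℝ)
          ≤ C * (eLpNorm (⇑f) (ENNReal.ofReal p) volume).toReal := by
  obtain ⟨m, rfl⟩ : ∃ m, n = m + 2 := ⟨n - 2, by omega⟩
  have hdim : (((m + 2 : ℕ) : ℝ)) - 1 = ((m + 1 : ℕ) : ℝ) := by push_cast; ring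
  rw [hdim]
  have hp0 : 0 < p := by linarith
  obtain ⟨D, hD, hbound⟩ := exists_sphere_restriction_sq_bound m hp1 (by
    rw [lt_div_iff₀ (by positivity)] at hp2
    push_cast at hp2
    linarith)
  refine ⟨√D.toReal + 1, by positivity, fun f => ?_⟩
  have hN : eLpNorm f (ENNReal.ofReal p) volume = (∫⁻ x, ‖f x‖ₑ ^ p) ^ (1 / p) := by
    rw [eLpNorm_eq_lintegral_rpow_enorm_toReal (by simpa using hp0) ENNReal.ofReal_ne_top,
      ENNReal.toReal_ofReal hp0.le]
  have hNtop : eLpNorm f (ENNReal.ofReal p) volume ≠ ⊤ := (f.memLp _ volume).eLpNorm_ne_top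
  have hA := hbound f f.continuous.measurable f.integrable
  have hN2 : (∫⁻ x, ‖f x‖ₑ ^ p) ^ (2 / p) = eLpNorm f (ENNReal.ofReal p) volume ^ 2 := by
    rw [hN, ← ENNReal.rpow_natCast, ← ENNReal.rpow_mul]
    congr 1
    push_cast; ring
  rw [hN2] at hA
  have hA' := (ENNReal.ofReal_le_iff_le_toReal
    (ENNReal.mul_ne_top (ENNReal.pow_ne_top hNtop) hD)).1 hA
  rw [ENNReal.toReal_mul, ENNReal.toReal_pow] at hA'
  rw [← Real.sqrt_eq_rpow]
  refine (Real.sqrt_le_sqrt hA').trans ?_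
  rw [Real.sqrt_mul (by positivity), Real.sqrt_sq ENNReal.toReal_nonneg, mul_comm]
  exact mul_le_mul_of_nonneg_right (by linarith) ENNReal.toReal_nonneg
end
end

section
/- The inverse Fourier transform κ of the canonical surface measure on the unit sphere S^{n-1} ⊂ ℝⁿ satisfies the pointwise bound |κ(x)| ≤ C (1+|x|)^{-(n-1)/2} for all x ∈ ℝⁿ and some constant C > 0 depending only on n. -/
open MeasureTheory Real
open scoped RealInnerProductSpace

noncomputable section

theorem integral_comp_inner_eq_of_norm_eq {E F : Type*} [NormedAddCommGroup E]
    [InnerProductSpace ℝ E] [MeasurableSpace E] [BorelSpace E] [NormedAddCommGroup F]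
    [NormedSpace ℝ F] {σ : Measure E}
    (hU : ∀ U : E ≃ₗᵢ[ℝ] E, MeasurePreserving U σ σ) (φ : ℝ → F) {x y : E} (h : ‖x‖ = ‖y‖) :
    ∫ ξ, φ ⟪x, ξ⟫ ∂σ = ∫ ξ, φ ⟪y, ξ⟫ ∂σ := by
  set U : E ≃ₗᵢ[ℝ] E := (Submodule.span ℝ {x - y})ᗮ.reflection
  have hUx : U x = y := Submodule.reflection_sub h
  rw [← (hU U).integral_comp U.toHomeomorph.measurableEmbedding (fun ξ => φ ⟪y, ξ⟫)]
  simp_rw [← hUx, LinearIsometryEquiv.inner_map_map]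

section SphereMeasure

variable {E : Type*} [NormedAddCommGroup E] [InnerProductSpace ℝ E] [FiniteDimensional ℝ E]
  [MeasurableSpace E] [BorelSpace E] {σ : Measure E}

theorem integrable_of_continuous_of_ae_norm_eq_one [IsFiniteMeasure σ]
    (hσ : ∀ᵐ ξ ∂σ, ‖ξ‖ = 1) {f : E → ℝ} (hf : Continuous f) : Integrable f σ := by
  obtain ⟨B, hB⟩ := (isCompact_sphere (0 : E) 1).exists_bound_of_continuousOn hf.continuousOn
  refine Integrable.of_bound hf.aestronglyMeasurable B ?_
  filter_upwards [hσ] with ξ hξ using hB ξ (by simpa using hξ)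

theorem hasDerivAt_integral_of_continuous_of_ae_norm_eq_one [IsFiniteMeasure σ]
    (hσ : ∀ᵐ ξ ∂σ, ‖ξ‖ = 1) {f f' : ℝ → E → ℝ} (hf : ∀ t, Continuous (f t))
    (hf' : Continuous fun p : ℝ × E => f' p.1 p.2)
    (hd : ∀ t ξ, HasDerivAt (fun s => f s ξ) (f' t ξ) t) (t : ℝ) :
    HasDerivAt (fun s => ∫ ξ, f s ξ ∂σ) (∫ ξ, f' t ξ ∂σ) t := by
  obtain ⟨B, hB⟩ := ((isCompact_closedBall t 1).prod
    (isCompact_sphere (0 : E) 1)).exists_bound_of_continuousOn hf'.continuousOn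
  refine (hasDerivAt_integral_of_dominated_loc_of_deriv_le (bound := fun _ => B)
    (Metric.closedBall_mem_nhds t one_pos)
    (.of_forall fun s => (hf s).aestronglyMeasurable)
    (integrable_of_continuous_of_ae_norm_eq_one hσ (hf t))
    (hf'.comp (Continuous.prodMk_right t)).aestronglyMeasurable ?_ (integrable_const B)
    (.of_forall fun ξ s _ => hd s ξ)).2
  filter_upwards [hσ] with ξ hξ s hs using hB (s, ξ) ⟨hs, by simpa using hξ⟩

theorem integral_cos_mul_sq_inner_eq [IsFiniteMeasure σ] (hσ : ∀ᵐ ξ ∂σ, ‖ξ‖ = 1)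
    (hU : ∀ U : E ≃ₗᵢ[ℝ] E, MeasurePreserving U σ σ) {u v : E} (hu : ‖u‖ = 1) (hv : ‖v‖ = 1)
    (huv : ⟪u, v⟫ = 0) (r : ℝ) :
    r * ∫ ξ, cos (r * ⟪u, ξ⟫) * ⟪v, ξ⟫ ^ 2 ∂σ = ∫ ξ, sin (r * ⟪u, ξ⟫) * ⟪u, ξ⟫ ∂σ := by
  obtain rfl | hr := eq_or_ne r 0
  · simp
  let a : ℝ → E → ℝ := fun t ξ => cos t * ⟪u, ξ⟫ + sin t * ⟪v, ξ⟫
  let b : ℝ → E → ℝ := fun t ξ => -sin t * ⟪u, ξ⟫ + cos t * ⟪v, ξ⟫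
  have ha : ∀ t ξ, HasDerivAt (fun s => a s ξ) (b t ξ) t := fun t ξ =>
    ((hasDerivAt_cos t).mul_const _).add ((hasDerivAt_sin t).mul_const _)
  have hb : ∀ t ξ, HasDerivAt (fun s => b s ξ) (-a t ξ) t := fun t ξ => by
    convert! ((hasDerivAt_sin t).neg.mul_const ⟪u, ξ⟫).add ((hasDerivAt_cos t).mul_const ⟪v, ξ⟫)
      using 1
    simp only [a]; ring
  have hac : Continuous fun p : ℝ × E => a p.1 p.2 := by fun_prop
  have hbc : Continuous fun p : ℝ × E => b p.1 p.2 := by fun_prop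
  have hac' : ∀ t, Continuous (a t) := fun t => by fun_prop
  have hbc' : ∀ t, Continuous (b t) := fun t => by fun_prop
  have hconst : ∀ t, ∫ ξ, cos (r * a t ξ) ∂σ = ∫ ξ, cos (r * ⟪u, ξ⟫) ∂σ := fun t => by
    have hn : ‖cos t • u + sin t • v‖ = ‖u‖ := by
      rw [hu, ← sq_eq_sq₀ (norm_nonneg _) zero_le_one, norm_add_sq_real, norm_smul, norm_smul,
        hu, hv, real_inner_smul_left, real_inner_smul_right, huv]
      simp
    have := integral_comp_inner_eq_of_norm_eq hU (fun s => cos (r * s)) hn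
    simpa only [inner_add_left, real_inner_smul_left] using this
  have hfirst : ∀ t, ∫ ξ, sin (r * a t ξ) * b t ξ ∂σ = 0 := fun t => by
    have h := hasDerivAt_integral_of_continuous_of_ae_norm_eq_one hσ
      (f := fun t ξ => cos (r * a t ξ)) (f' := fun t ξ => -r * (sin (r * a t ξ) * b t ξ))
      (fun t => by fun_prop) (by fun_prop) (fun t ξ => by
        convert! ((ha t ξ).const_mul r).cos using 1; ring) t
    simp_rw [hconst] at h
    have h0 := h.unique (hasDerivAt_const t _)
    rw [integral_const_mul] at h0
    simpa [hr] using h0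
  have h := hasDerivAt_integral_of_continuous_of_ae_norm_eq_one hσ
    (f := fun t ξ => sin (r * a t ξ) * b t ξ)
    (f' := fun t ξ => r * (cos (r * a t ξ) * b t ξ ^ 2) - sin (r * a t ξ) * a t ξ)
    (fun t => by fun_prop) (by fun_prop) (fun t ξ => by
      convert! (((ha t ξ).const_mul r).sin).mul (hb t ξ) using 1; ring) 0
  simp_rw [hfirst] at h
  have h0 := h.unique (hasDerivAt_const 0 _)
  rw [integral_sub, integral_const_mul, sub_eq_zero] at h0
  · simpa [a, b] using h0
  · exact integrable_of_continuous_of_ae_norm_eq_one hσ (by fun_prop)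
  · exact integrable_of_continuous_of_ae_norm_eq_one hσ (by fun_prop)

theorem integral_cos_mul_one_sub_sq_inner_eq [IsFiniteMeasure σ] (hσ : ∀ᵐ ξ ∂σ, ‖ξ‖ = 1)
    (hU : ∀ U : E ≃ₗᵢ[ℝ] E, MeasurePreserving U σ σ) {u : E} (hu : ‖u‖ = 1) (r : ℝ) :
    r * ∫ ξ, cos (r * ⟪u, ξ⟫) * (1 - ⟪u, ξ⟫ ^ 2) ∂σ =
      ((Module.finrank ℝ E : ℝ) - 1) * ∫ ξ, sin (r * ⟪u, ξ⟫) * ⟪u, ξ⟫ ∂σ := by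
  classical
  have ho : Orthonormal ℝ ((↑) : ({u} : Set E) → E) :=
    ⟨fun i => by rw [i.2, hu], fun i j h => (h (Subsingleton.elim i j)).elim⟩
  obtain ⟨s, b, hus, hb⟩ := ho.exists_orthonormalBasis_extension
  let i₀ : s := ⟨u, hus rfl⟩
  have hi₀ : b i₀ = u := by rw [hb]
  have hsum : ∀ᵐ ξ ∂σ, cos (r * ⟪u, ξ⟫) * (1 - ⟪u, ξ⟫ ^ 2) =
      ∑ i ∈ Finset.univ.erase i₀, cos (r * ⟪u, ξ⟫) * ⟪b i, ξ⟫ ^ 2 := by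
    filter_upwards [hσ] with ξ hξ
    rw [← Finset.mul_sum, Finset.sum_erase_eq_sub (Finset.mem_univ _), b.sum_sq_inner_right,
      hξ, hi₀, one_pow]
  have hcard : ((Finset.univ.erase i₀).card : ℝ) = (Module.finrank ℝ E : ℝ) - 1 := by
    rw [Module.finrank_eq_card_basis b.toBasis,
      Finset.cast_card_erase_of_mem (Finset.mem_univ i₀), Finset.card_univ]
  rw [integral_congr_ae hsum, integral_finsetSum, Finset.mul_sum, Finset.sum_congr rfl
    fun i hi => integral_cos_mul_sq_inner_eq hσ hU hu (b.norm_eq_one i)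
      (by rw [← hi₀]; exact b.orthonormal.2 (Finset.ne_of_mem_erase hi).symm) r,
    Finset.sum_const, nsmul_eq_mul, hcard]
  exact fun i _ => integrable_of_continuous_of_ae_norm_eq_one hσ (by fun_prop)

end SphereMeasure

/-- Solutions of the radial Helmholtz equation `g'' + (m / r) g' + k² g = 0` decay like
`r ^ (-m / 2)`. -/
theorem exists_sq_mul_pow_le_of_radial_helmholtz {g g' g'' : ℝ → ℝ} {k : ℝ} (hk : 0 < k) (m : ℕ)
    (hg : ∀ r, HasDerivAt g (g' r) r) (hg' : ∀ r, HasDerivAt g' (g'' r) r)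
    (hode : ∀ r, r * (g'' r + k ^ 2 * g r) = -m * g' r) :
    ∃ D, ∀ r, 1 ≤ r → g r ^ 2 * r ^ m ≤ D := by
  set p : ℝ := m / 2 with hp
  set M : ℝ := |p * (p - 1)| / k with hM
  let w : ℝ → ℝ := fun r => g' r + p / r * g r
  let H : ℝ → ℝ := fun r => r ^ m * (w r ^ 2 + k ^ 2 * g r ^ 2)
  have hH : ∀ r, 0 < r →
      HasDerivAt H (r ^ m * (2 * (p * (p - 1) / r ^ 2) * (w r * g r))) r := fun r hr => by
    have hpow : HasDerivAt (fun x : ℝ => x ^ m) (m * r ^ m / r) r := by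
      convert! hasDerivAt_pow m r using 1
      rcases m with _ | m
      · simp
      · field_simp; simp [pow_succ, mul_comm]
    have hw : HasDerivAt w (g'' r + (-p / r ^ 2 * g r + p / r * g' r)) r := by
      refine (hg' r).add (HasDerivAt.mul ?_ (hg r))
      simp only [div_eq_mul_inv, neg_mul]
      rw [← mul_neg]
      exact HasDerivAt.const_mul p (by simpa using hasDerivAt_inv hr.ne')
    have hg'' : g'' r = -k ^ 2 * g r - 2 * p / r * g' r := by
      have := hode r
      rw [hp]
      field_simp
      linarith
    convert! hpow.mul ((hw.pow 2).add (((hg r).pow 2).const_mul (k ^ 2))) using 1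
    have hm : (m : ℝ) = 2 * p := by rw [hp]; ring
    simp only [w, hg'', hm, Pi.add_apply, Pi.pow_apply, Nat.cast_ofNat, Nat.add_one_sub_one, pow_one]
    field_simp
    ring
  have hF : AntitoneOn (fun r => H r * exp (-M * (1 - 1 / r))) (Set.Ici 1) := by
    have hFd : ∀ r, 0 < r → HasDerivAt (fun r => H r * exp (-M * (1 - 1 / r)))
        ((r ^ m * (2 * (p * (p - 1) / r ^ 2) * (w r * g r)) - M / r ^ 2 * H r) *
          exp (-M * (1 - 1 / r))) r := fun r hr => by
      have he : HasDerivAt (fun r : ℝ => -M * (1 - 1 / r)) (-M / r ^ 2) r := by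
        have := ((hasDerivAt_inv hr.ne').const_sub 1).const_mul (-M)
        simp only [one_div]
        convert! this using 1
        field_simp
      convert! (hH r hr).mul he.exp using 1
      ring
    refine antitoneOn_of_hasDerivWithinAt_nonpos (convex_Ici 1)
      (fun r hr => (hFd r (one_pos.trans_le hr)).continuousAt.continuousWithinAt)
      (fun r hr => (hFd r (one_pos.trans_le (interior_subset hr))).hasDerivWithinAt)
      fun r hr => mul_nonpos_of_nonpos_of_nonneg ?_ (exp_pos _).le
    have hr0 : 0 < r := one_pos.trans_le (interior_subset hr)
    have h1 : 2 * (p * (p - 1)) * (w r * g r) ≤ M * (w r ^ 2 + k ^ 2 * g r ^ 2) := by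
      calc 2 * (p * (p - 1)) * (w r * g r) ≤ |2 * (p * (p - 1)) * (w r * g r)| := le_abs_self _
        _ = M * (2 * |w r| * (k * |g r|)) := by
          rw [hM]; simp only [abs_mul, abs_two]; field_simp
        _ ≤ M * (|w r| ^ 2 + (k * |g r|) ^ 2) := by
          gcongr; exact two_mul_le_add_sq _ _
        _ = _ := by rw [mul_pow, sq_abs, sq_abs]
    have h2 : r ^ m * (2 * (p * (p - 1) / r ^ 2) * (w r * g r)) - M / r ^ 2 * H r =
        r ^ m / r ^ 2 * (2 * (p * (p - 1)) * (w r * g r) - M * (w r ^ 2 + k ^ 2 * g r ^ 2)) := by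
      simp only [H]; ring
    rw [h2]
    exact mul_nonpos_of_nonneg_of_nonpos (by positivity) (by linarith)
  refine ⟨H 1 * exp M / k ^ 2, fun r hr => ?_⟩
  have hr0 : 0 < r := one_pos.trans_le hr
  have hle : H r * exp (-M * (1 - 1 / r)) ≤ H 1 := by
    simpa using hF Set.self_mem_Ici hr hr
  have hM0 : 0 ≤ M := by positivity
  have hexp : exp (M * (1 - 1 / r)) ≤ exp M :=
    exp_le_exp.2 (mul_le_of_le_one_right hM0 (by linarith [one_div_pos.2 hr0]))
  have hH1 : 0 ≤ H 1 := by simp only [H]; positivity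
  rw [le_div_iff₀ (by positivity)]
  calc g r ^ 2 * r ^ m * k ^ 2 ≤ H r := by
        have : 0 ≤ r ^ m * w r ^ 2 := by positivity
        simp only [H]; linarith
    _ = H r * exp (-M * (1 - 1 / r)) * exp (M * (1 - 1 / r)) := by
        rw [mul_assoc, ← exp_add]; simp
    _ ≤ H 1 * exp M := by gcongr

section SphereMeasure

variable {E : Type*} [NormedAddCommGroup E] [InnerProductSpace ℝ E] [FiniteDimensional ℝ E]
  [MeasurableSpace E] [BorelSpace E] {σ : Measure E}

theorem exists_sq_integral_cos_mul_pow_le [IsFiniteMeasure σ] (hσ : ∀ᵐ ξ ∂σ, ‖ξ‖ = 1)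
    (hU : ∀ U : E ≃ₗᵢ[ℝ] E, MeasurePreserving U σ σ) {m : ℕ} (hm : Module.finrank ℝ E = m + 1) :
    ∃ D, ∀ x : E, (∫ ξ, cos (2 * π * ⟪x, ξ⟫) ∂σ) ^ 2 * (1 + ‖x‖) ^ m ≤ D := by
  have : Nontrivial E := Module.nontrivial_of_finrank_pos (R := ℝ) (by omega)
  obtain ⟨u, hu⟩ := exists_norm_eq E zero_le_one
  let k : ℝ := 2 * π
  have hk : 0 < k := by positivity
  let g : ℝ → ℝ := fun r => ∫ ξ, cos (k * r * ⟪u, ξ⟫) ∂σ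
  let g' : ℝ → ℝ := fun r => ∫ ξ, -k * (sin (k * r * ⟪u, ξ⟫) * ⟪u, ξ⟫) ∂σ
  let g'' : ℝ → ℝ := fun r => ∫ ξ, -k ^ 2 * (cos (k * r * ⟪u, ξ⟫) * ⟪u, ξ⟫ ^ 2) ∂σ
  have hlin : ∀ r c, HasDerivAt (fun s => k * s * c) (k * c) r := fun r c => by
    simpa using ((hasDerivAt_id r).const_mul k).mul_const c
  have hg : ∀ r, HasDerivAt g (g' r) r :=
    hasDerivAt_integral_of_continuous_of_ae_norm_eq_one hσ (fun t => by fun_prop) (by fun_prop)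
      fun t ξ => by convert! (hlin t ⟪u, ξ⟫).cos using 1; ring
  have hg' : ∀ r, HasDerivAt g' (g'' r) r :=
    hasDerivAt_integral_of_continuous_of_ae_norm_eq_one hσ (fun t => by fun_prop) (by fun_prop)
      fun t ξ => by
        convert! (((hlin t ⟪u, ξ⟫).sin).mul_const ⟪u, ξ⟫).const_mul (-k) using 1; ring
  have hode : ∀ r, r * (g'' r + k ^ 2 * g r) = -m * g' r := fun r => by
    have h := integral_cos_mul_one_sub_sq_inner_eq hσ hU hu (k * r)
    have h1 : ∫ ξ, cos (k * r * ⟪u, ξ⟫) * (1 - ⟪u, ξ⟫ ^ 2) ∂σ =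
        g r - ∫ ξ, cos (k * r * ⟪u, ξ⟫) * ⟪u, ξ⟫ ^ 2 ∂σ := by
      rw [← integral_sub]
      · simp_rw [mul_sub, mul_one]
      · exact integrable_of_continuous_of_ae_norm_eq_one hσ (by fun_prop)
      · exact integrable_of_continuous_of_ae_norm_eq_one hσ (by fun_prop)
    rw [h1, hm] at h
    push_cast at h
    simp only [g'', g', integral_const_mul]
    linear_combination k * h
  obtain ⟨D, hD⟩ := exists_sq_mul_pow_le_of_radial_helmholtz hk m hg hg' hode
  refine ⟨2 ^ m * max D (σ.real Set.univ ^ 2), fun x => ?_⟩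
  have hx : ∫ ξ, cos (2 * π * ⟪x, ξ⟫) ∂σ = g ‖x‖ := by
    rw [integral_comp_inner_eq_of_norm_eq hU (fun s => cos (2 * π * s)) (y := ‖x‖ • u)
      (by simp [norm_smul, hu])]
    simp only [g, k, real_inner_smul_left, mul_assoc]
  rw [hx]
  obtain h | h := le_total 1 ‖x‖
  · calc g ‖x‖ ^ 2 * (1 + ‖x‖) ^ m ≤ g ‖x‖ ^ 2 * (2 * ‖x‖) ^ m := by gcongr; linarith
      _ = 2 ^ m * (g ‖x‖ ^ 2 * ‖x‖ ^ m) := by ring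
      _ ≤ _ := by gcongr; exact (hD _ h).trans (le_max_left _ _)
  · have hgb : |g ‖x‖| ≤ σ.real Set.univ := by
      simpa using norm_integral_le_of_norm_le_const (μ := σ) (C := 1)
        (f := fun ξ => cos (k * ‖x‖ * ⟪u, ξ⟫)) (.of_forall fun ξ => abs_cos_le_one _)
    calc g ‖x‖ ^ 2 * (1 + ‖x‖) ^ m ≤ σ.real Set.univ ^ 2 * 2 ^ m := by
          rw [← sq_abs]; gcongr; linarith
      _ ≤ _ := by rw [mul_comm]; gcongr; exact le_max_right _ _

theorem norm_integral_cexp_inner_eq [IsFiniteMeasure σ] (hσ : ∀ᵐ ξ ∂σ, ‖ξ‖ = 1)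
    (hU : ∀ U : E ≃ₗᵢ[ℝ] E, MeasurePreserving U σ σ) (x : E) :
    ‖∫ ξ, Complex.exp (2 * π * Complex.I * (⟪x, ξ⟫ : ℝ)) ∂σ‖ =
      |∫ ξ, cos (2 * π * ⟪x, ξ⟫) ∂σ| := by
  have hsin : ∫ ξ, sin (2 * π * ⟪x, ξ⟫) ∂σ = 0 := by
    have h := integral_comp_inner_eq_of_norm_eq hU (fun s => sin (2 * π * s)) (norm_neg x)
    simp only [inner_neg_left, mul_neg, sin_neg, integral_neg] at h
    linarith
  have hexp : ∀ ξ, Complex.exp (2 * π * Complex.I * (⟪x, ξ⟫ : ℝ)) =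
      (cos (2 * π * ⟪x, ξ⟫) : ℂ) + (sin (2 * π * ⟪x, ξ⟫) : ℂ) * Complex.I := fun ξ => by
    push_cast
    rw [← Complex.exp_mul_I]
    congr 1
    ring
  simp_rw [hexp]
  rw [integral_add, integral_mul_const, integral_complex_ofReal, integral_complex_ofReal, hsin]
  · simp
  · exact (integrable_of_continuous_of_ae_norm_eq_one hσ (f := fun ξ => cos (2 * π * ⟪x, ξ⟫))
      (by fun_prop)).ofReal
  · exact (integrable_of_continuous_of_ae_norm_eq_one hσ (f := fun ξ => sin (2 * π * ⟪x, ξ⟫))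
      (by fun_prop)).ofReal.mul_const _

end SphereMeasure

/-- The inverse Fourier transform `κ(x) = ∫_{S^{n-1}} e^{2πi x·ξ} dσ(ξ)` of the canonical
surface measure on the unit sphere satisfies `|κ(x)| ≤ C (1+|x|)^{-(n-1)/2}`. -/
theorem inv_fourier_sphere_measure_decay (n : ℕ) (hn : 2 ≤ n) :
    ∃ C : ℝ, 0 < C ∧
      ∀ x : EuclideanSpace ℝ (Fin n),
        ‖∫ ξ in Metric.sphere (0 : EuclideanSpace ℝ (Fin n)) 1,
            Complex.exp (2 * π * Complex.I * (⟪x, ξ⟫ : ℝ)) ∂(μH[(n : ℝ) - 1])‖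
          ≤ C * (1 + ‖x‖) ^ (-((n : ℝ) - 1) / 2) := by
  obtain ⟨m, rfl⟩ : ∃ m, n = m + 1 := ⟨n - 1, by omega⟩
  set S := Metric.sphere (0 : EuclideanSpace ℝ (Fin (m + 1))) 1
  set σ := (μH[((m + 1 : ℕ) : ℝ) - 1] : Measure (EuclideanSpace ℝ (Fin (m + 1)))).restrict S
    with hσdef
  by_cases hfin : IsFiniteMeasure σ
  · have hσ : ∀ᵐ ξ ∂σ, ‖ξ‖ = 1 := by
      filter_upwards [ae_restrict_mem Metric.isClosed_sphere.measurableSet] with ξ hξ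
      simpa [S] using hξ
    have hU : ∀ U : EuclideanSpace ℝ (Fin (m + 1)) ≃ₗᵢ[ℝ] EuclideanSpace ℝ (Fin (m + 1)),
        MeasurePreserving U σ σ := fun U => by
      have h := (U.toIsometryEquiv.measurePreserving_hausdorffMeasure
        (((m + 1 : ℕ) : ℝ) - 1)).restrict_preimage
        (Metric.isClosed_sphere (x := (0 : EuclideanSpace ℝ (Fin (m + 1)))) (ε := 1)).measurableSet
      have hS : U.toIsometryEquiv ⁻¹' S = S := by
        ext ξ; simp [S]
      rw [hS] at h
      exact h
    obtain ⟨D, hD⟩ := exists_sq_integral_cos_mul_pow_le hσ hU (m := m) (by simp)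
    refine ⟨√D + 1, by positivity, fun x => ?_⟩
    rw [norm_integral_cexp_inner_eq hσ hU]
    have hx : 0 < 1 + ‖x‖ := by positivity
    have hexp : (1 + ‖x‖) ^ (-(((m + 1 : ℕ) : ℝ) - 1) / 2) = (√((1 + ‖x‖) ^ m))⁻¹ := by
      rw [sqrt_eq_rpow, ← rpow_natCast, ← rpow_mul hx.le, ← rpow_neg hx.le]
      congr 1
      push_cast
      ring
    rw [hexp, ← div_eq_mul_inv, le_div_iff₀ (by positivity)]
    refine le_trans ?_ (le_add_of_nonneg_right zero_le_one)
    rw [← sqrt_sq_eq_abs, ← sqrt_mul (sq_nonneg _)]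
    exact sqrt_le_sqrt (hD x)
  · refine ⟨1, one_pos, fun x => ?_⟩
    rw [integral_undef, norm_zero]
    · positivity
    · intro hint
      refine hfin ((integrable_const_iff_isFiniteMeasure (one_ne_zero (α := ℝ))).1 ?_)
      convert! hint.norm using 2 with ξ
      rw [Complex.norm_exp]
      simp
end
end
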